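/- For every integer i ≥ 0, the polynomial c_i^{(2)}(q) of Theorem 1.1 (case r = 2) equals ∑_{k=0}^{i} q^{2·C(i−k,2)} · [2k choose i]_q · [i choose k]_q^2, where C(m,2) = m(m−1)/2; in particular this sum is a polynomial in q with nonnegative integer coefficients. -/

import Mathlib

open Polynomial LaurentPolynomial Finset

/-- The Gaussian (q-)binomial coefficient `[n choose k]_q` as a polynomial in `q`,
defined by the q-Pascal recursion; it equals `(q)_n / ((q)_k (q)_{n-k})` for `0 ≤ k ≤ n`
and vanishes for `k > n`. -/
noncomputable def qbinom : ℕ → ℕ → Polynomial ℤ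
  | _, 0 => 1
  | 0, _ + 1 => 0
  | n + 1, k + 1 => qbinom n k + Polynomial.X ^ (k + 1) * qbinom n (k + 1)

/-- `[n choose k]_q` viewed as a Laurent polynomial. -/
noncomputable def qb (n k : ℕ) : LaurentPolynomial ℤ := (qbinom n k).toLaurent

lemma qbinom_zero_right (n : ℕ) : qbinom n 0 = 1 := by
  cases n <;> simp [qbinom]

lemma qbinom_succ_succ (n k : ℕ) :
    qbinom (n + 1) (k + 1) = qbinom n k + X ^ (k + 1) * qbinom n (k + 1) := by
  rw [qbinom]

lemma qbinom_eq_zero_of_lt {n k : ℕ} (h : n < k) : qbinom n k = 0 := by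
  induction n generalizing k with
  | zero =>
    obtain ⟨k, rfl⟩ := Nat.exists_eq_succ_of_ne_zero h.ne'
    simp [qbinom]
  | succ n ih =>
    obtain ⟨k, rfl⟩ := Nat.exists_eq_succ_of_ne_zero (Nat.ne_zero_of_lt h)
    rw [Nat.succ_eq_add_one, qbinom_succ_succ, ih (by omega), ih (by omega)]
    simp

lemma qbinom_self (n : ℕ) : qbinom n n = 1 := by
  induction n with
  | zero => exact qbinom_zero_right 0
  | succ n ih => rw [qbinom_succ_succ, ih, qbinom_eq_zero_of_lt (by omega)]; simp

/-- The q-factorial `(q)_n = (1 - q)(1 - q²)⋯(1 - qⁿ)`. -/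
noncomputable def qPoch (n : ℕ) : Polynomial ℤ := ∏ i ∈ range n, (1 - X ^ (i + 1))

lemma qPoch_succ (n : ℕ) : qPoch (n + 1) = qPoch n * (1 - X ^ (n + 1)) := by
  rw [qPoch, prod_range_succ, ← qPoch]

lemma qPoch_ne_zero (n : ℕ) : qPoch n ≠ 0 := by
  refine prod_ne_zero_iff.2 fun i _ h => ?_
  have := congrArg (Polynomial.eval 0) h
  simp at this

lemma qbinom_mul_qPoch (a b : ℕ) : qbinom (a + b) a * (qPoch a * qPoch b) = qPoch (a + b) := by
  induction a generalizing b with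
  | zero => simp [qbinom_zero_right, qPoch]
  | succ a iha =>
    induction b with
    | zero => simp [qbinom_self, qPoch]
    | succ b ihb =>
      have h1 := iha (b + 1)
      have h2 : a + 1 + (b + 1) = (a + b + 1) + 1 := by ring
      rw [h2, qbinom_succ_succ, qPoch_succ (a + b + 1)]
      rw [show a + 1 + b = a + b + 1 by ring, qPoch_succ a] at ihb
      rw [show a + (b + 1) = a + b + 1 by ring, qPoch_succ b] at h1
      rw [qPoch_succ a, qPoch_succ b]
      linear_combination (1 - X ^ (a + 1)) * h1 + X ^ (a + 1) * (1 - X ^ (b + 1)) * ihb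

lemma qbinom_symm (a b : ℕ) : qbinom (a + b) a = qbinom (a + b) b := by
  have h1 := qbinom_mul_qPoch a b
  have h2 := qbinom_mul_qPoch b a
  rw [add_comm b a] at h2
  refine mul_right_cancel₀ (mul_ne_zero (qPoch_ne_zero a) (qPoch_ne_zero b)) ?_
  linear_combination h1 - h2

lemma qbinom_mul_qbinom (a b c : ℕ) :
    qbinom (a + b + c) (a + b) * qbinom (a + b) a = qbinom (a + b + c) a * qbinom (b + c) b := by
  have h1 := qbinom_mul_qPoch (a + b) c
  have h2 := qbinom_mul_qPoch a b
  have h3 := qbinom_mul_qPoch a (b + c)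
  have h4 := qbinom_mul_qPoch b c
  rw [← add_assoc] at h3
  refine mul_right_cancel₀ (mul_ne_zero (mul_ne_zero (qPoch_ne_zero a) (qPoch_ne_zero b))
    (qPoch_ne_zero c)) ?_
  linear_combination qbinom (a + b + c) (a + b) * qPoch c * h2 + h1
    - qbinom (a + b + c) a * qPoch a * h4 - h3

/-- The q-Vandermonde identity. -/
lemma qbinom_add (a b n : ℕ) :
    qbinom (a + b) n
      = ∑ i ∈ range (n + 1), X ^ ((a - i) * (n - i)) * qbinom a i * qbinom b (n - i) := by
  induction a generalizing n with
  | zero =>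
    rw [sum_range_succ', sum_eq_zero]
    · simp [qbinom_zero_right]
    · intro i _
      simp [qbinom_eq_zero_of_lt (Nat.succ_pos i)]
  | succ a ih =>
    cases n with
    | zero => simp [qbinom_zero_right]
    | succ n =>
      rw [show a + 1 + b = a + b + 1 by ring, qbinom_succ_succ, ih n, ih (n + 1),
        sum_range_succ' _ (n + 1), sum_range_succ' _ (n + 1), mul_add, mul_sum, ← add_assoc,
        ← sum_add_distrib]
      congr 1
      · refine sum_congr rfl fun i hi => ?_
        have hi : i ≤ n := by simpa [Nat.lt_succ_iff] using hi
        obtain ⟨j, rfl⟩ := Nat.exists_eq_add_of_le hi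
        rw [qbinom_succ_succ, Nat.add_sub_add_right, Nat.add_sub_add_right, Nat.add_sub_cancel_left]
        rcases lt_or_ge a (i + 1) with h | h
        · rw [qbinom_eq_zero_of_lt h]; ring
        · obtain ⟨d, rfl⟩ := Nat.exists_eq_add_of_le h
          rw [show i + 1 + d - i = d + 1 by omega, Nat.add_sub_cancel_left]
          ring
      · simp only [qbinom_zero_right, Nat.sub_zero]
        ring

/-- The q-Vandermonde identity, summed over the range of a shifted lower index. -/
lemma qbinom_add_shift (a i m : ℕ) :
    ∑ t ∈ range (a + 1), X ^ (t * (i + t)) * qbinom a t * qbinom (m + i) (i + t)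
      = qbinom (m + i + a) (a + i) := by
  have hsym : qbinom (m + i + a) (a + i) = qbinom (m + i + a) m := by
    rw [show m + i + a = m + (a + i) by ring]
    exact (qbinom_symm _ _).symm
  rw [hsym, qbinom_add, ← sum_range_reflect _ (m + 1)]
  have key : ∀ M, m ≤ M →
      ∑ t ∈ range (m + 1), X ^ (t * (i + t)) * qbinom a t * qbinom (m + i) (i + t)
      = ∑ t ∈ range (M + 1), X ^ (t * (i + t)) * qbinom a t * qbinom (m + i) (i + t) := by
    intro M hM
    refine sum_subset (range_mono (by omega)) fun t _ ht => ?_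
    rw [qbinom_eq_zero_of_lt (n := m + i) (by simp at ht; omega), mul_zero]
  have key' : ∀ M, a ≤ M →
      ∑ t ∈ range (a + 1), X ^ (t * (i + t)) * qbinom a t * qbinom (m + i) (i + t)
      = ∑ t ∈ range (M + 1), X ^ (t * (i + t)) * qbinom a t * qbinom (m + i) (i + t) := by
    intro M hM
    refine sum_subset (range_mono (by omega)) fun t _ ht => ?_
    rw [qbinom_eq_zero_of_lt (n := a) (by simp at ht; omega), mul_zero, zero_mul]
  rw [key' (a + m) (by omega), ← key (a + m) (by omega)]
  refine sum_congr rfl fun t ht => ?_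
  have ht : t ≤ m := by simpa [Nat.lt_succ_iff] using ht
  obtain ⟨s, rfl⟩ := Nat.exists_eq_add_of_le ht
  rw [show t + s + 1 - 1 - t = s by omega, show t + s + i - s = i + t by omega,
    show t + s - s = t by omega, show t + s + i = s + (i + t) by ring, qbinom_symm s (i + t)]
  ring

lemma sum_qbinom_mul_qbinom_mul_qbinom (m k i : ℕ) :
    ∑ j ∈ range (k + 1), X ^ ((m - j) * (k - j) + (j - i) * (m + k - i)) *
        (qbinom m j * qbinom k j * qbinom j i)
      = if i ≤ m then X ^ ((k - i) * (m - i)) * qbinom k i * qbinom (m + k - i) k else 0 := by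
  rcases lt_or_ge m i with him | him
  · rw [if_neg (by omega)]
    refine sum_eq_zero fun j _ => ?_
    rcases lt_or_ge j i with h | h
    · simp [qbinom_eq_zero_of_lt h]
    · simp [qbinom_eq_zero_of_lt (him.trans_le h)]
  rw [if_pos him]
  rcases lt_or_ge k i with hik | hik
  · rw [qbinom_eq_zero_of_lt hik, mul_zero, zero_mul]
    refine sum_eq_zero fun j hj => ?_
    rw [qbinom_eq_zero_of_lt (n := j) (k := i) (by simp at hj; omega)]
    simp
  obtain ⟨m, rfl⟩ := Nat.exists_eq_add_of_le' him
  obtain ⟨k, rfl⟩ := Nat.exists_eq_add_of_le' hik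
  rw [show k + i + 1 = i + (k + 1) by ring, sum_range_add, sum_eq_zero, zero_add,
    show m + i + (k + i) - i = m + i + k by omega, ← qbinom_add_shift, mul_sum]
  · refine sum_congr rfl fun t ht => ?_
    have ht : t ≤ k := by simpa [Nat.lt_succ_iff] using ht
    obtain ⟨s, rfl⟩ := Nat.exists_eq_add_of_le ht
    rcases lt_or_ge m t with hmt | hmt
    · rw [qbinom_eq_zero_of_lt (n := m + i) (by omega)]
      ring
    obtain ⟨d, rfl⟩ := Nat.exists_eq_add_of_le hmt
    have h := qbinom_mul_qbinom i t s
    rw [show t + s + i = i + t + s by ring]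
    rw [show t + d + i - (i + t) = d by omega, show i + t + s - (i + t) = s by omega,
      show i + t - i = t by omega, show i + t + s - i = t + s by omega,
      show t + d + i - i = t + d by omega]
    calc _ = X ^ (d * s + t * (t + d + i + (t + s))) * qbinom (t + d + i) (i + t) *
            (qbinom (i + t + s) (i + t) * qbinom (i + t) i) := by ring
      _ = _ := by rw [h]; ring
  · intro j hj
    rw [qbinom_eq_zero_of_lt (n := j) (k := i) (by simpa using hj)]
    simp

/-- Linearization of a product of two q-binomial coefficients (a form of the
q-Pfaff–Saalschütz identity). -/
lemma sum_qbinom_add_mul_qbinom_mul_qbinom (N m k : ℕ) (hk : k ≤ N) :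
    ∑ j ∈ range (k + 1), X ^ ((m - j) * (k - j)) *
        (qbinom (N + j) (m + k) * qbinom m j * qbinom k j)
      = qbinom N m * qbinom N k := by
  have h1 : ∀ j, X ^ ((m - j) * (k - j)) * (qbinom (N + j) (m + k) * qbinom m j * qbinom k j)
      = ∑ i ∈ range (m + k + 1), qbinom N (m + k - i) *
        (X ^ ((m - j) * (k - j) + (j - i) * (m + k - i)) *
        (qbinom m j * qbinom k j * qbinom j i)) := by
    intro j
    rw [add_comm N j, qbinom_add, sum_mul, sum_mul, mul_sum]
    refine sum_congr rfl fun i _ => ?_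
    ring
  simp_rw [h1]
  rw [sum_comm]
  simp_rw [← mul_sum, sum_qbinom_mul_qbinom_mul_qbinom]
  rw [show m + k + 1 = m + 1 + k by ring, sum_range_add, sum_eq_zero (s := range k), add_zero]
  · obtain ⟨r, rfl⟩ := Nat.exists_eq_add_of_le hk
    rw [qbinom_add k r m, sum_mul]
    refine sum_congr rfl fun i hi => ?_
    have hi : i ≤ m := by simpa [Nat.lt_succ_iff] using hi
    rw [if_pos hi]
    obtain ⟨d, rfl⟩ := Nat.exists_eq_add_of_le hi
    rw [show i + d + k - i = k + d by omega, show i + d - i = d by omega]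
    rcases lt_or_ge r d with hd | hd
    · rw [qbinom_eq_zero_of_lt hd, qbinom_eq_zero_of_lt (n := k + r) (k := k + d) (by omega)]
      ring
    obtain ⟨e, rfl⟩ := Nat.exists_eq_add_of_le hd
    have h := qbinom_mul_qbinom k d e
    rw [← add_assoc]
    linear_combination X ^ ((k - i) * d) * qbinom k i * h
  · intro i _
    rw [if_neg (by omega), mul_zero]

lemma two_mul_choose_two_cast (n : ℕ) : 2 * ((n.choose 2 : ℕ) : ℤ) = n * (n - 1) := by
  induction n with
  | zero => simp
  | succ n ih =>
    rw [Nat.choose_succ_succ' n 1, Nat.choose_one_right]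
    push_cast
    linarith

lemma qbinom_products_eq (m k j : ℕ) :
    qbinom (m + k) (k + j) * qbinom (m + k + (k + j)) (k + j) *
        (qbinom (2 * k) (k + j) * qbinom (k + j) k ^ 2)
      = qbinom (m + k) k * qbinom (2 * k) k *
        (qbinom (m + 2 * k + j) (k + m) * qbinom k j * qbinom m j) := by
  rcases lt_or_ge k j with hk | hk
  · rw [qbinom_eq_zero_of_lt hk, qbinom_eq_zero_of_lt (n := 2 * k) (k := k + j) (by omega)]
    ring
  rcases lt_or_ge m j with hm | hm
  · rw [qbinom_eq_zero_of_lt hm, qbinom_eq_zero_of_lt (n := m + k) (k := k + j) (by omega)]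
    ring
  have h1 : qbinom (m + k) (k + j) * qbinom (k + j) k = qbinom (m + k) k * qbinom m j := by
    obtain ⟨d, rfl⟩ := Nat.exists_eq_add_of_le hm
    have := qbinom_mul_qbinom k j d
    rwa [show k + j + d = j + d + k by ring] at this
  have h2 : qbinom (2 * k) (k + j) * qbinom (k + j) k = qbinom (2 * k) k * qbinom k j := by
    obtain ⟨d, rfl⟩ := Nat.exists_eq_add_of_le hk
    have := qbinom_mul_qbinom (j + d) j d
    rwa [show j + d + j + d = 2 * (j + d) by ring] at this
  have h3 : qbinom (m + k + (k + j)) (k + j) = qbinom (m + 2 * k + j) (k + m) := by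
    rw [← qbinom_symm, show m + k + (k + j) = m + 2 * k + j by ring, add_comm m k]
  rw [h3]
  linear_combination qbinom (m + 2 * k + j) (k + m) * qbinom (2 * k) (k + j) *
    qbinom (k + j) k * h1 + qbinom (m + 2 * k + j) (k + m) * qbinom (m + k) k * qbinom m j * h2

lemma qbinom_sq_mul_qbinom_sq (m k : ℕ) :
    qbinom (m + k) k ^ 2 * qbinom (m + k + k) k ^ 2
      = ∑ j ∈ range (m + 1), X ^ ((k - j) * (m - j)) *
        (qbinom (m + k) (k + j) * qbinom (m + k + (k + j)) (k + j) *
        (qbinom (2 * k) (k + j) * qbinom (k + j) k ^ 2)) := by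
  have h := sum_qbinom_add_mul_qbinom_mul_qbinom (m + 2 * k) k m (by omega)
  have h1 : qbinom (m + 2 * k) m * qbinom (2 * k) k = qbinom (m + 2 * k) k * qbinom (m + k) k := by
    have := qbinom_mul_qbinom k k m
    rw [show k + k + m = m + 2 * k by ring, show k + k = 2 * k by ring, ← qbinom_symm,
      add_comm k m] at this
    exact this
  simp_rw [qbinom_products_eq, mul_left_comm (X ^ _ : Polynomial ℤ) (qbinom (m + k) k * qbinom (2 * k) k)]
  rw [← mul_sum, h, show m + k + k = m + 2 * k by ring]
  linear_combination -qbinom (m + k) k * qbinom (m + 2 * k) k * h1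

lemma T_mul_qb_sq_mul_qb_sq (n k : ℕ) (hk : k ≤ n) :
    T (2 * ((n - k).choose 2 : ℤ) - (n.choose 2 : ℤ)) * qb n k ^ 2 * qb (n + k) k ^ 2
      = ∑ i ∈ range (n + 1), T (((n - i).choose 2 : ℤ) - (i.choose 2 : ℤ)) *
          qb n i * qb (n + i) i *
          (X ^ (2 * (i - k).choose 2) * qbinom (2 * k) i * qbinom i k ^ 2).toLaurent := by
  obtain ⟨m, rfl⟩ := Nat.exists_eq_add_of_le' hk
  have h := congrArg Polynomial.toLaurent (qbinom_sq_mul_qbinom_sq m k)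
  rw [map_mul, map_pow, map_pow, map_sum] at h
  rw [show m + k + 1 = k + (m + 1) by ring, sum_range_add, sum_eq_zero, zero_add, mul_assoc]
  · simp only [qb]
    rw [h, mul_sum]
    refine sum_congr rfl fun j hj => ?_
    have hj : j ≤ m := by simpa [Nat.lt_succ_iff] using hj
    rcases lt_or_ge k j with hkj | hkj
    · rw [qbinom_eq_zero_of_lt (n := 2 * k) (k := k + j) (by omega)]
      simp
    obtain ⟨d, rfl⟩ := Nat.exists_eq_add_of_le hj
    obtain ⟨e, rfl⟩ := Nat.exists_eq_add_of_le hkj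
    simp only [map_mul, Polynomial.toLaurent_X_pow]
    rw [show j + d + (j + e) - (j + e) = j + d by omega, show j + e - j = e by omega,
      show j + d - j = d by omega, show j + d + (j + e) - (j + e + j) = d by omega,
      show j + e + j - (j + e) = j by omega]
    have hexp : (2 * ((j + d).choose 2 : ℤ) - ((j + d + (j + e)).choose 2 : ℤ)) + ((e * d : ℕ) : ℤ)
        = ((d.choose 2 : ℤ) - ((j + e + j).choose 2 : ℤ)) + ((2 * j.choose 2 : ℕ) : ℤ) := by
      have h1 := two_mul_choose_two_cast (j + d)
      have h2 := two_mul_choose_two_cast (j + d + (j + e))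
      have h3 := two_mul_choose_two_cast d
      have h4 := two_mul_choose_two_cast (j + e + j)
      have h5 := two_mul_choose_two_cast j
      push_cast at *
      linarith
    have hT := congrArg (T (R := ℤ)) hexp
    rw [T_add, T_add] at hT
    linear_combination (Polynomial.toLaurent (qbinom (j + d + (j + e)) (j + e + j)) *
      Polynomial.toLaurent (qbinom (j + d + (j + e) + (j + e + j)) (j + e + j)) *
      (Polynomial.toLaurent (qbinom (2 * (j + e)) (j + e + j)) *
      Polynomial.toLaurent (qbinom (j + e + j) (j + e) ^ 2))) * hT
  · intro i hi
    rw [qbinom_eq_zero_of_lt (n := i) (k := k) (by simpa using hi)]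
    simp

lemma sum_T_mul_qb_sq_mul_qb_sq (n : ℕ) :
    ∑ k ∈ range (n + 1),
        T (2 * ((n - k).choose 2 : ℤ) - (n.choose 2 : ℤ)) * qb n k ^ 2 * qb (n + k) k ^ 2
      = ∑ i ∈ range (n + 1), T (((n - i).choose 2 : ℤ) - (i.choose 2 : ℤ)) *
          qb n i * qb (n + i) i *
          (∑ k ∈ range (i + 1),
            X ^ (2 * (i - k).choose 2) * qbinom (2 * k) i * qbinom i k ^ 2).toLaurent := by
  rw [sum_congr rfl fun k hk =>
    T_mul_qb_sq_mul_qb_sq n k (by simpa [Nat.lt_succ_iff] using hk), sum_comm]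
  refine sum_congr rfl fun i hi => ?_
  rw [← mul_sum, ← map_sum]
  congr 2
  refine (sum_subset (range_mono (by simp at hi; omega)) fun k _ hk => ?_).symm
  rw [qbinom_eq_zero_of_lt (n := i) (k := k) (by simp at hk; omega)]
  simp

lemma qb_ne_zero {n k : ℕ} (h : k ≤ n) : qb n k ≠ 0 := by
  obtain ⟨m, rfl⟩ := Nat.exists_eq_add_of_le h
  intro h0
  rw [qb, Polynomial.toLaurent_eq_zero] at h0
  have := qbinom_mul_qPoch k m
  rw [h0, zero_mul] at this
  exact qPoch_ne_zero _ this.symm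

/-- The case `r = 2` of Theorem 1.1:
`c_i^{(2)}(q) = ∑_{k=0}^i q^{2 C(i-k,2)} [2k,i]_q [i,k]_q²`, a polynomial in `q` with
nonnegative integer coefficients. Here `c` is the sequence of polynomials of Theorem 1.1
for `r = 2`, characterized by the hypotheses. -/
theorem qSchmidt_c_two
    (c : ℕ → Polynomial ℤ)
    (hcnonneg : ∀ i : ℕ, ∀ m : ℕ, 0 ≤ (c i).coeff m)
    (hcid : ∀ n : ℕ,
      ∑ k ∈ range (n + 1),
        T (2 * ((n - k).choose 2 : ℤ) - (n.choose 2 : ℤ)) *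
          qb n k ^ 2 * qb (n + k) k ^ 2
      = ∑ i ∈ range (n + 1),
        T (((n - i).choose 2 : ℤ) - (i.choose 2 : ℤ)) *
          qb n i * qb (n + i) i * (c i).toLaurent) :
    ∀ i : ℕ, c i
      = ∑ k ∈ range (i + 1),
          Polynomial.X ^ (2 * (i - k).choose 2) * qbinom (2 * k) i * qbinom i k ^ 2 := by
  intro i
  induction i using Nat.strong_induction_on with
  | _ n ih =>
    have h := (hcid n).symm.trans (sum_T_mul_qb_sq_mul_qb_sq n)
    rw [sum_range_succ, sum_range_succ _ n] at h
    rw [sum_congr rfl fun i hi => by rw [ih i (mem_range.1 hi)]] at h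
    have h' := add_left_cancel h
    refine Polynomial.toLaurent_injective (mul_left_cancel₀ (mul_ne_zero (mul_ne_zero ?_
      (qb_ne_zero le_rfl)) (qb_ne_zero (Nat.le_add_left n n))) h')
    exact (isUnit_T _).ne_zero
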